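/- With α(p) = (3p − 2 + √(5p² − 8p + 4))/(2p) for p ∈ (0,1], the quantity γ_p = ∫₀^∞ log x dν_{α(p)}(x) tends to 0 as p tends to 0 from the right. -/

import Mathlib

open MeasureTheory Filter Set Topology

noncomputable section

/-- Endpoints (as pairs of nonnegative integers, `(a,b)` representing `a/b`, with `1/0 = ∞`)
of the Stern-Brocot interval obtained from `[0/1, 1/0]` by following the list of choices `w`
(`true` = left sub-interval, `false` = right sub-interval). -/
def sbGo : (ℕ × ℕ) × (ℕ × ℕ) → List Bool → (ℕ × ℕ) × (ℕ × ℕ)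
  | I, [] => I
  | ((a, b), (c, d)), (lft :: w) =>
      if lft then sbGo ((a, b), (a + c, b + d)) w else sbGo ((a + c, b + d), (c, d)) w

/-- The Stern-Brocot interval of rank `w.length` indexed by the list of choices `w`. -/
def sb (w : List Bool) : (ℕ × ℕ) × (ℕ × ℕ) := sbGo ((0, 1), (1, 0)) w

/-- The intersection of a Stern-Brocot interval with `[0, ∞)`, as a subset of `ℝ`. -/
def sbSet : (ℕ × ℕ) × (ℕ × ℕ) → Set ℝ
  | ((a, b), (c, d)) =>
      if d = 0 then Set.Ici ((a : ℝ) / (b : ℝ))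
      else Set.Icc ((a : ℝ) / (b : ℝ)) ((c : ℝ) / (d : ℝ))

/-- `ν` is the measure `ν_α`: a Borel probability measure on `[0,∞)` (viewed as a measure on `ℝ`
giving no mass to `(-∞,0)`) with `ν([0,1]) = 1 - α`, `ν([1,∞)) = α`, and such that for every
Stern-Brocot interval `I` of rank `r ≥ 1`, the left sub-interval of `I` carries a proportion `α`
of the mass of `I` if `r` is odd and `1 - α` if `r` is even. -/
def IsSternBrocotMeasure (α : ℝ) (ν : Measure ℝ) : Prop :=
  IsProbabilityMeasure ν ∧
  ν (Set.Iio 0) = 0 ∧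
  ν (Set.Icc 0 1) = ENNReal.ofReal (1 - α) ∧
  ν (Set.Ici 1) = ENNReal.ofReal α ∧
  ∀ w : List Bool, 1 ≤ w.length →
    ν (sbSet (sb (w ++ [true]))) =
      (if Odd w.length then ENNReal.ofReal α else ENNReal.ofReal (1 - α)) * ν (sbSet (sb w))

/-- The mediant of the endpoints of an interval. -/
def sbMediant (I : (ℕ × ℕ) × (ℕ × ℕ)) : ℕ × ℕ := (I.1.1 + I.2.1, I.1.2 + I.2.2)

/-- The left (`true`) or right (`false`) sub-interval. -/
def sbChild (I : (ℕ × ℕ) × (ℕ × ℕ)) (b : Bool) : (ℕ × ℕ) × (ℕ × ℕ) :=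
  if b then (I.1, sbMediant I) else (sbMediant I, I.2)

/-- The Stern-Brocot interval indexed by a list of choices whose head is the last choice. -/
def sbRev : List Bool → (ℕ × ℕ) × (ℕ × ℕ)
  | [] => ((0, 1), (1, 0))
  | b :: w => sbChild (sbRev w) b

/-- The value of the mediant as a real number. -/
def sbMid (w : List Bool) : ℝ :=
  ((sbMediant (sbRev w)).1 : ℝ) / ((sbMediant (sbRev w)).2 : ℝ)

/-- The proportion of the mass of an interval of rank `n` carried by a sub-interval. -/
def sbRatio (α : ℝ) (n : ℕ) (b : Bool) : ℝ := if b = decide (Odd n) then α else 1 - α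

/-- The mass given by `ν_α` to the interval `sbRev w`. -/
def sbMass (α : ℝ) : List Bool → ℝ
  | [] => 1
  | b :: w => sbRatio α w.length b * sbMass α w

/-- The sum of `log mediant * mass` over the descendants of `sbRev w` in the `n`-th generation. -/
def sbLogSum (α : ℝ) : ℕ → List Bool → ℝ
  | 0, w => Real.log (sbMid w) * sbMass α w
  | n + 1, w => sbLogSum α n (true :: w) + sbLogSum α n (false :: w)

lemma sbGo_append (I : (ℕ × ℕ) × (ℕ × ℕ)) (u v : List Bool) :
    sbGo I (u ++ v) = sbGo (sbGo I u) v := by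
  induction u generalizing I with
  | nil => simp [sbGo]
  | cons b u ih =>
    obtain ⟨⟨a, b'⟩, c, d⟩ := I
    cases b <;> simp [sbGo, ih]

lemma sbGo_singleton (I : (ℕ × ℕ) × (ℕ × ℕ)) (b : Bool) : sbGo I [b] = sbChild I b := by
  obtain ⟨⟨a, b'⟩, c, d⟩ := I
  cases b <;> simp [sbGo, sbChild, sbMediant]

lemma sb_reverse (w : List Bool) : sb w.reverse = sbRev w := by
  induction w with
  | nil => simp [sb, sbGo, sbRev]
  | cons b w ih =>
    rw [List.reverse_cons, sb, sbGo_append, sbGo_singleton, ← sb, ih, sbRev]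

/-- Endpoints are unimodular, and an interval of rank `n` with endpoints `0 < a/b < c/d < ∞` has
`n ≤ a d + 1`. -/
lemma sbRev_spec (w : List Bool) :
    (sbRev w).1.2 * (sbRev w).2.1 = (sbRev w).1.1 * (sbRev w).2.2 + 1 ∧
    (sbRev w = ((0, 1), (1, w.length)) ∨ sbRev w = ((w.length, 1), (1, 0)) ∨
      (1 ≤ (sbRev w).1.1 ∧ 1 ≤ (sbRev w).2.2 ∧
        w.length ≤ (sbRev w).1.1 * (sbRev w).2.2 + 1)) := by
  induction w with
  | nil => simp [sbRev]
  | cons b w ih =>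
    simp only [sbRev, List.length_cons]
    generalize sbRev w = I at *
    generalize w.length = n at *
    obtain ⟨⟨p, q⟩, r, s⟩ := I
    obtain ⟨h, h'⟩ := ih
    simp only [Prod.mk.injEq] at h h'
    refine ⟨?_, ?_⟩
    · cases b <;> simp [sbChild, sbMediant] <;> nlinarith
    · have hq : 1 ≤ q := by
        rcases Nat.eq_zero_or_pos q with rfl | hq
        · simp at h
        · exact hq
      have hr : 1 ≤ r := by
        rcases Nat.eq_zero_or_pos r with rfl | hr
        · simp at h
        · exact hr
      rcases h' with ⟨⟨rfl, rfl⟩, rfl, rfl⟩ | ⟨⟨rfl, rfl⟩, rfl, rfl⟩ | ⟨hp, hs, hn⟩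
      · cases b
        · rcases Nat.eq_zero_or_pos s with rfl | hs
          · simp [sbChild, sbMediant]
          · right; right; simp [sbChild, sbMediant]; omega
        · left; simp [sbChild, sbMediant]; omega
      · cases b
        · right; left; simp [sbChild, sbMediant]
        · rcases Nat.eq_zero_or_pos p with rfl | hs
          · simp [sbChild, sbMediant]
          · right; right; simp [sbChild, sbMediant]; omega
      · right; right
        cases b
        · simp only [sbChild, sbMediant, Bool.false_eq_true, if_false]
          refine ⟨by omega, hs, ?_⟩
          nlinarith
        · simp only [sbChild, sbMediant, if_true]
          refine ⟨hp, by omega, ?_⟩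
          nlinarith

lemma sbSet_root : sbSet (sbRev []) = Ici 0 := by simp [sbRev, sbSet]

lemma measurableSet_sbSet (I : (ℕ × ℕ) × (ℕ × ℕ)) : MeasurableSet (sbSet I) := by
  obtain ⟨⟨a, b⟩, c, d⟩ := I
  unfold sbSet
  dsimp only
  split_ifs
  · exact measurableSet_Ici
  · exact measurableSet_Icc

lemma sbSet_split (w : List Bool) :
    sbSet (sbRev w) = sbSet (sbRev (true :: w)) ∪ sbSet (sbRev (false :: w)) ∧
    sbSet (sbRev (true :: w)) ∩ sbSet (sbRev (false :: w)) = {sbMid w} := by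
  have h := (sbRev_spec w).1
  simp only [sbRev, sbMid]
  generalize sbRev w = I at *
  obtain ⟨⟨a, b⟩, c, d⟩ := I
  simp only [sbChild, sbMediant, if_true, Bool.false_eq_true, if_false, sbSet] at *
  have hb : 1 ≤ b := by
    rcases Nat.eq_zero_or_pos b with rfl | hb
    · simp at h
    · exact hb
  have hb' : (0 : ℝ) < b := by exact_mod_cast hb
  have hR : (b : ℝ) * c = a * d + 1 := by exact_mod_cast h
  have h0 : ¬ (b + d = 0) := by omega
  have h1 : (a : ℝ) / b ≤ ((a + c : ℕ) : ℝ) / ((b + d : ℕ) : ℝ) := by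
    rw [div_le_div_iff₀ hb' (by exact_mod_cast (by omega : 0 < b + d))]
    push_cast; nlinarith
  rw [if_neg h0]
  split_ifs with hd
  · rw [Icc_union_Ici_eq_Ici h1]
    refine ⟨rfl, ?_⟩
    ext x
    simp only [mem_inter_iff, mem_Icc, mem_Ici, mem_singleton_iff]
    constructor
    · rintro ⟨⟨_, h2⟩, h3⟩; exact le_antisymm h2 h3
    · rintro rfl; exact ⟨⟨h1, le_rfl⟩, le_rfl⟩
  · have h2 : ((a + c : ℕ) : ℝ) / ((b + d : ℕ) : ℝ) ≤ (c : ℝ) / d := by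
      rw [div_le_div_iff₀ (by exact_mod_cast (by omega : 0 < b + d))
        (by exact_mod_cast (by omega : 0 < d))]
      push_cast; nlinarith
    exact ⟨(Icc_union_Icc_eq_Icc h1 h2).symm, Icc_inter_Icc_eq_singleton h1 h2⟩

lemma sbRev_replicate_true_fst (k : ℕ) (w : List Bool) :
    (sbRev (List.replicate k true ++ w)).1 = (sbRev w).1 := by
  induction k with
  | zero => simp
  | succ k ih => rw [List.replicate_succ, List.cons_append, sbRev, sbChild]; simpa using ih

lemma sbRev_replicate_true (k : ℕ) : sbRev (List.replicate k true) = ((0, 1), (1, k)) := by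
  induction k with
  | zero => simp [sbRev]
  | succ k ih =>
    rw [List.replicate_succ, sbRev, ih]
    simp [sbChild, sbMediant, add_comm]

lemma sbRev_replicate_false (k : ℕ) : sbRev (List.replicate k false) = ((k, 1), (1, 0)) := by
  induction k with
  | zero => simp [sbRev]
  | succ k ih =>
    rw [List.replicate_succ, sbRev, ih]
    simp [sbChild, sbMediant]

lemma sbMid_mem_replicate (k : ℕ) (w : List Bool) :
    sbMid w ∈ sbSet (sbRev (List.replicate k true ++ false :: w)) := by
  have h1 := sbRev_replicate_true_fst k (false :: w)
  have h := (sbRev_spec (List.replicate k true ++ false :: w)).1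
  simp only [sbMid]
  have h2 : sbMediant (sbRev w) = (sbRev (List.replicate k true ++ false :: w)).1 := by
    rw [h1]; simp [sbRev, sbChild]
  rw [h2]
  generalize sbRev (List.replicate k true ++ false :: w) = I at *
  obtain ⟨⟨a, b⟩, c, d⟩ := I
  simp only [sbSet] at *
  have hb : 1 ≤ b := by
    rcases Nat.eq_zero_or_pos b with rfl | hb
    · simp at h
    · exact hb
  have hR : (b : ℝ) * c = a * d + 1 := by exact_mod_cast h
  split_ifs with hd
  · exact mem_Ici.2 le_rfl
  · refine ⟨le_rfl, ?_⟩
    rw [div_le_div_iff₀ (by exact_mod_cast hb) (by exact_mod_cast (by omega : 0 < d))]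
    nlinarith

lemma sbRatio_mem {α : ℝ} (hα : α ∈ Icc (1 / 3 : ℝ) (2 / 3)) (n : ℕ) (b : Bool) :
    sbRatio α n b ∈ Icc (0 : ℝ) (2 / 3) := by
  obtain ⟨h1, h2⟩ := hα
  unfold sbRatio
  split_ifs <;> constructor <;> linarith

lemma sbRatio_add (α : ℝ) (n : ℕ) : sbRatio α n true + sbRatio α n false = 1 := by
  unfold sbRatio
  by_cases h : Odd n <;> simp [h]

lemma sbMass_mem {α : ℝ} (hα : α ∈ Icc (1 / 3 : ℝ) (2 / 3)) (w : List Bool) :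
    sbMass α w ∈ Icc (0 : ℝ) ((2 / 3) ^ w.length) := by
  induction w with
  | nil => simp [sbMass]
  | cons b w ih =>
    have h := sbRatio_mem hα w.length b
    rw [sbMass, List.length_cons, pow_succ']
    exact ⟨mul_nonneg h.1 ih.1, mul_le_mul h.2 ih.2 ih.1 (by norm_num)⟩

namespace IsSternBrocotMeasure

variable {α : ℝ} {μ : Measure ℝ}

lemma measureReal_left (h : IsSternBrocotMeasure α μ) (hα : α ∈ Icc (1 / 3 : ℝ) (2 / 3))
    (w : List Bool) :
    μ.real (sbSet (sbRev (true :: w))) =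
      sbRatio α w.length true * μ.real (sbSet (sbRev w)) := by
  obtain ⟨hp, hneg, hleft, -, hrec⟩ := h
  have h1 : 0 ≤ α := by linarith [hα.1]
  have h2 : 0 ≤ 1 - α := by linarith [hα.2]
  cases w with
  | nil =>
    have hu : μ.real (Ici (0 : ℝ)) = 1 := by
      rw [← compl_Iio, measureReal_compl measurableSet_Iio]
      simp [Measure.real, hneg]
    rw [sbSet_root, hu]
    have : sbSet (sbRev [true]) = Icc 0 1 := by simp [sbRev, sbChild, sbMediant, sbSet]
    rw [this, Measure.real, hleft, ENNReal.toReal_ofReal h2]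
    simp [sbRatio]
  | cons b w =>
    have := hrec (b :: w).reverse (by simp)
    rw [← List.reverse_cons, sb_reverse, sb_reverse, List.length_reverse] at this
    rw [Measure.real, this, ENNReal.toReal_mul, Measure.real]
    congr 1
    unfold sbRatio
    by_cases ho : Odd (b :: w).length
    · rw [if_pos ho, if_pos (by simpa using ho), ENNReal.toReal_ofReal h1]
    · rw [if_neg ho, if_neg (by simpa using ho), ENNReal.toReal_ofReal h2]

lemma measureReal_replicate_le (h : IsSternBrocotMeasure α μ)
    (hα : α ∈ Icc (1 / 3 : ℝ) (2 / 3)) (w : List Bool) (k : ℕ) :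
    μ.real (sbSet (sbRev (List.replicate k true ++ w))) ≤ (2 / 3) ^ k := by
  have := h.1
  induction k with
  | zero => simp
  | succ k ih =>
    rw [List.replicate_succ, List.cons_append, h.measureReal_left hα, pow_succ']
    exact mul_le_mul (sbRatio_mem hα _ _).2 ih measureReal_nonneg (by norm_num)

lemma measure_sbMid (h : IsSternBrocotMeasure α μ) (hα : α ∈ Icc (1 / 3 : ℝ) (2 / 3))
    (w : List Bool) : μ {sbMid w} = 0 := by
  have := h.1
  have h0 : μ.real {sbMid w} ≤ 0 := by
    refine ge_of_tendsto' (tendsto_pow_atTop_nhds_zero_of_lt_one (r := (2 / 3 : ℝ))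
      (by norm_num) (by norm_num)) fun k => ?_
    exact (measureReal_mono (singleton_subset_iff.2 (sbMid_mem_replicate k w))).trans
      (h.measureReal_replicate_le hα _ k)
  exact (measureReal_eq_zero_iff (by simp)).1 (le_antisymm h0 measureReal_nonneg)

lemma aedisjoint (h : IsSternBrocotMeasure α μ) (hα : α ∈ Icc (1 / 3 : ℝ) (2 / 3))
    (w : List Bool) :
    AEDisjoint μ (sbSet (sbRev (true :: w))) (sbSet (sbRev (false :: w))) := by
  rw [AEDisjoint, (sbSet_split w).2, h.measure_sbMid hα]

lemma measureReal_eq (h : IsSternBrocotMeasure α μ) (hα : α ∈ Icc (1 / 3 : ℝ) (2 / 3))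
    (w : List Bool) : μ.real (sbSet (sbRev w)) = sbMass α w := by
  have := h.1
  induction w with
  | nil =>
    rw [sbSet_root, ← compl_Iio, measureReal_compl measurableSet_Iio]
    simp [Measure.real, h.2.1, sbMass]
  | cons b w ih =>
    have hl := h.measureReal_left hα w
    rw [ih] at hl
    cases b with
    | true => exact hl
    | false =>
      have hs : μ.real (sbSet (sbRev w)) = _ :=
        congrArg μ.real (sbSet_split w).1
      rw [measureReal_union₀ (measurableSet_sbSet _).nullMeasurableSet (h.aedisjoint hα w),
        ih, hl] at hs
      have hr := sbRatio_add α w.length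
      rw [sbMass]
      linear_combination -hs - sbMass α w * hr

lemma measure_le (h : IsSternBrocotMeasure α μ) (hα : α ∈ Icc (1 / 3 : ℝ) (2 / 3))
    (w : List Bool) : μ (sbSet (sbRev w)) ≤ ENNReal.ofReal ((2 / 3) ^ w.length) := by
  have := h.1
  rw [← ofReal_measureReal, h.measureReal_eq hα]
  exact ENNReal.ofReal_le_ofReal (sbMass_mem hα w).2

lemma measure_Ici_le (h : IsSternBrocotMeasure α μ) (hα : α ∈ Icc (1 / 3 : ℝ) (2 / 3))
    (k : ℕ) : μ (Ici (k : ℝ)) ≤ ENNReal.ofReal ((2 / 3) ^ k) := by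
  simpa [sbRev_replicate_false, sbSet] using h.measure_le hα (List.replicate k false)

lemma measure_Icc_le (h : IsSternBrocotMeasure α μ) (hα : α ∈ Icc (1 / 3 : ℝ) (2 / 3))
    {k : ℕ} (hk : 1 ≤ k) : μ (Icc 0 (k : ℝ)⁻¹) ≤ ENNReal.ofReal ((2 / 3) ^ k) := by
  have hk0 : k ≠ 0 := by omega
  simpa [sbRev_replicate_true, sbSet, hk0] using h.measure_le hα (List.replicate k true)

end IsSternBrocotMeasure

/-- A pointwise bound for the distance between `log x` and the logarithm of the mediant of the
Stern-Brocot interval of rank `n` containing `x`. -/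
def sbErr (n : ℕ) (x : ℝ) : ENNReal :=
  ENNReal.ofReal (1 / (n - 1)) + (∑' k : ℕ, (Ici ((n + k : ℕ) : ℝ)).indicator 1 x) +
    ∑' k : ℕ, (Icc (0 : ℝ) ((n + k : ℕ) : ℝ)⁻¹).indicator 1 x

lemma abs_log_sub_log_le {n : ℕ} (hn : 1 ≤ n) {x : ℝ} (hx : (n : ℝ) ≤ x) :
    |Real.log x - Real.log (n + 1)| ≤ (⌊x⌋₊ - n + 1 : ℕ) := by
  have hn' : (1 : ℝ) ≤ n := by exact_mod_cast hn
  have hx0 : 0 < x := by linarith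
  have hfl : n ≤ ⌊x⌋₊ := Nat.le_floor hx
  have hfl' : (n : ℝ) ≤ ⌊x⌋₊ := by exact_mod_cast hfl
  have hlt := Nat.lt_floor_add_one x
  push_cast [Nat.cast_sub hfl]
  rw [abs_le, ← Real.log_div hx0.ne' (by positivity)]
  constructor
  · have h1 := Real.one_sub_inv_le_log_of_pos (x := x / (n + 1)) (by positivity)
    have h2 : (x / (n + 1))⁻¹ ≤ 2 := by
      rw [inv_div, div_le_iff₀ hx0]; linarith
    linarith
  · have h1 := Real.log_le_sub_one_of_pos (x := x / (n + 1)) (by positivity)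
    have h2 : x / (n + 1) ≤ x - n + 1 := by
      rw [div_le_iff₀ (by positivity)]; nlinarith
    linarith

lemma enorm_log_sub_log_le_tsum {n : ℕ} (hn : 1 ≤ n) {x : ℝ} (hx : (n : ℝ) ≤ x) :
    ‖Real.log x - Real.log (n + 1)‖ₑ ≤
      ∑' k : ℕ, (Ici ((n + k : ℕ) : ℝ)).indicator (1 : ℝ → ENNReal) x := by
  have hfl : n ≤ ⌊x⌋₊ := Nat.le_floor hx
  have hx0 : 0 ≤ x := (Nat.cast_nonneg n).trans hx
  calc ‖Real.log x - Real.log (n + 1)‖ₑ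
      ≤ ((⌊x⌋₊ - n + 1 : ℕ) : ENNReal) := by
        rw [← ofReal_norm, Real.norm_eq_abs, ← ENNReal.ofReal_natCast]
        exact ENNReal.ofReal_le_ofReal (abs_log_sub_log_le hn hx)
    _ = ∑ k ∈ Finset.range (⌊x⌋₊ - n + 1),
          (Ici ((n + k : ℕ) : ℝ)).indicator (1 : ℝ → ENNReal) x := by
        rw [Finset.sum_congr rfl (g := fun _ => 1)]
        · simp
        · intro k hk
          rw [Finset.mem_range] at hk
          rw [indicator_of_mem, Pi.one_apply]
          exact (Nat.le_floor_iff hx0).1 (by omega)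
    _ ≤ _ := ENNReal.sum_le_tsum _

lemma enorm_log_sub_log_mid_le {w : List Bool} (hw : 2 ≤ w.length) {x : ℝ}
    (hx : x ∈ sbSet (sbRev w)) :
    ‖Real.log x - Real.log (sbMid w)‖ₑ ≤ sbErr w.length x := by
  obtain ⟨hdet, h⟩ := sbRev_spec w
  unfold sbMid sbErr
  generalize w.length = n at *
  generalize sbRev w = I at *
  rcases h with rfl | rfl | ⟨ha, hd, hn⟩
  · refine le_trans ?_ le_add_self
    have hn0 : n ≠ 0 := by omega
    simp only [sbSet, hn0, if_false, mem_Icc, Nat.cast_zero, Nat.cast_one, div_one,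
      one_div] at hx
    simp only [sbMediant]
    rcases hx.1.eq_or_lt with rfl | hx0
    · have : ∀ k : ℕ, (Icc (0 : ℝ) ((n + k : ℕ) : ℝ)⁻¹).indicator (1 : ℝ → ENNReal) 0 = 1 := by
        intro k
        rw [indicator_of_mem, Pi.one_apply]
        exact ⟨le_rfl, by positivity⟩
      simp only [this]
      rw [ENNReal.tsum_const_eq_top_of_ne_zero one_ne_zero]
      exact le_top
    · have hn0 : (0 : ℝ) < n := by exact_mod_cast (by omega : 0 < n)
      have h1 : (n : ℝ) ≤ x⁻¹ := (le_inv_comm₀ hn0 hx0).2 hx.2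
      have h2 := enorm_log_sub_log_le_tsum (by omega) h1
      refine (Eq.le ?_).trans (h2.trans (Eq.le ?_))
      · rw [← enorm_neg]
        congr 1
        push_cast
        rw [Real.log_inv, one_div, Real.log_inv, add_comm (1 : ℝ)]
        ring
      · refine tsum_congr fun k => ?_
        have hk : (0 : ℝ) < ((n + k : ℕ) : ℝ) := by exact_mod_cast (by omega : 0 < n + k)
        simp only [indicator, mem_Icc, mem_Ici, hx0.le, true_and, Pi.one_apply,
          le_inv_comm₀ hx0 hk]
  · refine le_trans ?_ (le_add_right le_add_self)
    simp only [sbSet, if_true, Nat.cast_one, div_one] at hx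
    simpa [sbMediant] using enorm_log_sub_log_le_tsum (by omega) hx
  · rw [add_assoc]
    refine le_trans ?_ le_self_add
    obtain ⟨⟨a, b⟩, c, d⟩ := I
    simp only at hd ha hn hdet
    have hd0 : d ≠ 0 := by omega
    simp only [sbMediant, sbSet, hd0, if_false, mem_Icc] at *
    have hR : (b : ℝ) * c = a * d + 1 := by exact_mod_cast hdet
    have hb : 1 ≤ b := by
      rcases Nat.eq_zero_or_pos b with rfl | hb
      · simp at hdet
      · exact hb
    have hc : 1 ≤ c := by
      rcases Nat.eq_zero_or_pos c with rfl | hc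
      · simp at hdet
      · exact hc
    have hb' : (0 : ℝ) < b := by exact_mod_cast hb
    have hd' : (0 : ℝ) < d := by exact_mod_cast hd
    have ha' : (0 : ℝ) < a := by exact_mod_cast ha
    have hc' : (0 : ℝ) < c := by exact_mod_cast hc
    have hn' : (n : ℝ) ≤ a * d + 1 := by exact_mod_cast hn
    have hn2 : (2 : ℝ) ≤ n := by exact_mod_cast hw
    push_cast
    have hm1 : (a : ℝ) / b ≤ (a + c) / (b + d) := by
      rw [div_le_div_iff₀ hb' (by positivity)]; nlinarith
    have hm2 : ((a : ℝ) + c) / (b + d) ≤ c / d := by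
      rw [div_le_div_iff₀ (by positivity) hd']; nlinarith
    have hab : 0 < (a : ℝ) / b := by positivity
    have l1 := Real.log_le_log hab hx.1
    have l2 := Real.log_le_log (hab.trans_le hx.1) hx.2
    have l3 := Real.log_le_log hab hm1
    have l4 := Real.log_le_log (hab.trans_le hm1) hm2
    have l5 : Real.log ((c : ℝ) / d) - Real.log (a / b) ≤ 1 / (a * d) := by
      rw [← Real.log_div (by positivity) (by positivity)]
      have h3 : (c : ℝ) / d / (a / b) = 1 + 1 / (a * d) := by
        field_simp; linarith
      have := Real.log_le_sub_one_of_pos (x := (c : ℝ) / d / (a / b)) (by positivity)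
      linarith
    have l6 : 1 / ((a : ℝ) * d) ≤ 1 / (n - 1) :=
      one_div_le_one_div_of_le (by linarith) (by linarith)
    rw [← ofReal_norm, Real.norm_eq_abs]
    refine ENNReal.ofReal_le_ofReal ?_
    rw [abs_le]
    constructor <;> linarith

lemma tsum_ofReal_two_thirds_pow (n : ℕ) :
    ∑' k : ℕ, ENNReal.ofReal ((2 / 3) ^ (n + k)) = ENNReal.ofReal (3 * (2 / 3) ^ n) := by
  have hs : Summable fun k : ℕ => (2 / 3 : ℝ) ^ (n + k) := by
    simp only [pow_add]
    exact (summable_geometric_of_lt_one (by norm_num) (by norm_num)).mul_left _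
  rw [← ENNReal.ofReal_tsum_of_nonneg (fun k => by positivity) hs]
  simp only [pow_add]
  rw [tsum_mul_left, tsum_geometric_of_lt_one (by norm_num) (by norm_num)]
  congr 1
  ring

namespace IsSternBrocotMeasure

variable {α : ℝ} {μ : Measure ℝ}

lemma lintegral_sbErr_le (h : IsSternBrocotMeasure α μ) (hα : α ∈ Icc (1 / 3 : ℝ) (2 / 3))
    {n : ℕ} (hn : 2 ≤ n) :
    ∫⁻ x, sbErr n x ∂μ ≤ ENNReal.ofReal (1 / (n - 1) + 6 * (2 / 3) ^ n) := by
  have := h.1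
  have hn2 : (2 : ℝ) ≤ n := by exact_mod_cast hn
  have m1 : ∀ k : ℕ, Measurable ((Ici ((n + k : ℕ) : ℝ)).indicator (1 : ℝ → ENNReal)) :=
    fun k => measurable_one.indicator measurableSet_Ici
  have m2 : ∀ k : ℕ,
      Measurable ((Icc (0 : ℝ) ((n + k : ℕ) : ℝ)⁻¹).indicator (1 : ℝ → ENNReal)) :=
    fun k => measurable_one.indicator measurableSet_Icc
  unfold sbErr
  rw [lintegral_add_right _ (Measurable.tsum m2),
    lintegral_add_right _ (Measurable.tsum m1),
    lintegral_tsum fun k => (m1 k).aemeasurable, lintegral_tsum fun k => (m2 k).aemeasurable]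
  simp only [lintegral_indicator_one measurableSet_Ici, lintegral_indicator_one measurableSet_Icc,
    lintegral_const, measure_univ, mul_one]
  have e : (1 / (n - 1) + 6 * (2 / 3) ^ n : ℝ) =
      1 / (n - 1) + 3 * (2 / 3) ^ n + 3 * (2 / 3) ^ n := by ring
  have hpos : (0 : ℝ) ≤ 1 / (n - 1) := one_div_nonneg.2 (by linarith)
  rw [e, ENNReal.ofReal_add (by positivity) (by positivity),
    ENNReal.ofReal_add hpos (by positivity), ← tsum_ofReal_two_thirds_pow]
  refine add_le_add (add_le_add le_rfl ?_) ?_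
  · exact ENNReal.tsum_le_tsum fun k => h.measure_Ici_le hα _
  · exact ENNReal.tsum_le_tsum fun k => h.measure_Icc_le hα (by omega)

lemma enorm_setIntegral_log_sub_le (h : IsSternBrocotMeasure α μ)
    (hα : α ∈ Icc (1 / 3 : ℝ) (2 / 3)) (hint : Integrable Real.log μ) (n : ℕ) (w : List Bool)
    (hn : 2 ≤ n + w.length) :
    ‖∫ x in sbSet (sbRev w), Real.log x ∂μ - sbLogSum α n w‖ₑ ≤
      ∫⁻ x in sbSet (sbRev w), sbErr (n + w.length) x ∂μ := by
  have := h.1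
  induction n generalizing w with
  | zero =>
    rw [zero_add] at hn ⊢
    have e : ∫ x in sbSet (sbRev w), Real.log x ∂μ - sbLogSum α 0 w =
        ∫ x in sbSet (sbRev w), (Real.log x - Real.log (sbMid w)) ∂μ := by
      rw [integral_sub hint.integrableOn (integrable_const _), setIntegral_const,
        h.measureReal_eq hα, sbLogSum, smul_eq_mul, mul_comm]
    rw [e]
    exact (enorm_integral_le_lintegral_enorm _).trans
      (setLIntegral_mono' (measurableSet_sbSet _) fun x hx => enorm_log_sub_log_mid_le hn hx)
  | succ n ih =>
    have ht := ih (true :: w) (by simp; omega)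
    have hf := ih (false :: w) (by simp; omega)
    have hl : ∀ b : Bool, n + (b :: w).length = n + 1 + w.length := by
      intro b; simp; omega
    rw [hl] at ht hf
    have hm := (measurableSet_sbSet (sbRev (false :: w))).nullMeasurableSet (μ := μ)
    rw [(sbSet_split w).1, Measure.restrict_union₀ (h.aedisjoint hα w) hm,
      lintegral_add_measure, integral_add_measure hint.integrableOn hint.integrableOn, sbLogSum,
      add_sub_add_comm]
    exact (enorm_add_le _ _).trans (add_le_add ht hf)

lemma abs_integral_log_le (h : IsSternBrocotMeasure α μ) (hα : α ∈ Icc (1 / 3 : ℝ) (2 / 3))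
    {n : ℕ} (hn : 2 ≤ n) :
    |∫ x, Real.log x ∂μ| ≤ |sbLogSum α n []| + (1 / (n - 1) + 6 * (2 / 3) ^ n) := by
  have hn2 : (2 : ℝ) ≤ n := by exact_mod_cast hn
  have hpos : (0 : ℝ) ≤ 1 / (n - 1) := one_div_nonneg.2 (by linarith)
  by_cases hint : Integrable Real.log μ
  · have h1 := h.enorm_setIntegral_log_sub_le hα hint n [] (by simpa using hn)
    have hr : μ.restrict (Ici 0) = μ := by
      rw [Measure.restrict_eq_self_of_ae_mem]
      rw [ae_iff]
      simpa [Iio_def] using h.2.1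
    rw [sbSet_root, hr, List.length_nil, add_zero] at h1
    have h2 := h1.trans (h.lintegral_sbErr_le hα hn)
    rw [← ofReal_norm, Real.norm_eq_abs,
      ENNReal.ofReal_le_ofReal_iff (by positivity)] at h2
    have h3 := abs_sub_abs_le_abs_sub (∫ x, Real.log x ∂μ) (sbLogSum α n [])
    linarith
  · rw [integral_undef hint]
    simp only [abs_zero]
    positivity

end IsSternBrocotMeasure

lemma continuous_sbMass (w : List Bool) : Continuous fun α => sbMass α w := by
  induction w with
  | nil => exact continuous_const
  | cons b w ih =>
    simp only [sbMass]
    refine Continuous.mul ?_ ih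
    unfold sbRatio
    split_ifs <;> fun_prop

lemma continuous_sbLogSum (n : ℕ) (w : List Bool) : Continuous fun α => sbLogSum α n w := by
  induction n generalizing w with
  | zero => exact continuous_const.mul (continuous_sbMass w)
  | succ n ih => exact (ih _).add (ih _)

lemma sbMass_half_map_not (w : List Bool) :
    sbMass (1 / 2) (w.map not) = sbMass (1 / 2) w := by
  have hr : ∀ n b, sbRatio (1 / 2) n b = 1 / 2 := by
    intro n b; unfold sbRatio; split_ifs <;> norm_num
  induction w with
  | nil => simp
  | cons b w ih => simp only [List.map_cons, sbMass, hr, ih]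

lemma sbRev_map_not (w : List Bool) :
    sbRev (w.map not) = ((sbRev w).2.swap, (sbRev w).1.swap) := by
  induction w with
  | nil => simp [sbRev]
  | cons b w ih =>
    rw [List.map_cons, sbRev, ih, sbRev]
    cases b <;> simp [sbChild, sbMediant, add_comm]

lemma sbLogSum_half_map_not (n : ℕ) (w : List Bool) :
    sbLogSum (1 / 2) n (w.map not) = -sbLogSum (1 / 2) n w := by
  induction n generalizing w with
  | zero =>
    have : sbMid (w.map not) = (sbMid w)⁻¹ := by
      simp [sbMid, sbRev_map_not, sbMediant, add_comm]
    rw [sbLogSum, sbLogSum, sbMass_half_map_not, this, Real.log_inv, neg_mul]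
  | succ n ih =>
    have h1 := ih (true :: w)
    have h2 := ih (false :: w)
    simp only [List.map_cons, Bool.not_true, Bool.not_false] at h1 h2
    rw [sbLogSum, sbLogSum, h1, h2]
    ring

lemma sbLogSum_half_nil (n : ℕ) : sbLogSum (1 / 2) n [] = 0 := by
  have := sbLogSum_half_map_not n []
  rw [List.map_nil] at this
  linarith

lemma tendsto_fibonacci_alpha :
    Tendsto (fun p : ℝ => (3 * p - 2 + Real.sqrt (5 * p ^ 2 - 8 * p + 4)) / (2 * p))
      (𝓝[>] 0) (𝓝 (1 / 2)) := by
  have hc : ContinuousAt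
      (fun p : ℝ => (2 - 2 * p) / (Real.sqrt (5 * p ^ 2 - 8 * p + 4) + (2 - 3 * p))) 0 := by
    refine ContinuousAt.div (by fun_prop) (by fun_prop) ?_
    have := Real.sqrt_nonneg (5 * 0 ^ 2 - 8 * 0 + 4)
    linarith
  have h4 : Real.sqrt (5 * 0 ^ 2 - 8 * 0 + 4) = 2 := by
    rw [show (5 * 0 ^ 2 - 8 * 0 + 4 : ℝ) = 2 ^ 2 by norm_num, Real.sqrt_sq (by norm_num)]
  have hl : Tendsto _ _ _ := hc.tendsto.mono_left (nhdsWithin_le_nhds (s := Ioi 0))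
  rw [h4] at hl
  norm_num at hl
  refine (hl.congr' ?_).trans (by norm_num)
  filter_upwards [Ioo_mem_nhdsGT (show (0 : ℝ) < 1 / 2 by norm_num)] with p hp
  have hs := Real.sqrt_nonneg (5 * p ^ 2 - 8 * p + 4)
  have hsq := Real.sq_sqrt (show 0 ≤ 5 * p ^ 2 - 8 * p + 4 by nlinarith [sq_nonneg (p - 4 / 5)])
  have hp0 := hp.1
  have hp1 := hp.2
  rw [div_eq_div_iff (by linarith) (by linarith)]
  linear_combination -hsq

/-- `γ_p = ∫ log x dν_{α(p)}(x)`, with `α(p) = (3p - 2 + √(5p² - 8p + 4))/(2p)`, tends to `0`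
as `p → 0⁺`. -/
theorem gamma_tendsto_zero
    (ν : ℝ → Measure ℝ) (hν : ∀ α ∈ Set.Icc (0 : ℝ) 1, IsSternBrocotMeasure α (ν α)) :
    Tendsto (fun p : ℝ =>
        ∫ x, Real.log x ∂(ν ((3 * p - 2 + Real.sqrt (5 * p ^ 2 - 8 * p + 4)) / (2 * p))))
      (nhdsWithin 0 (Set.Ioi 0)) (𝓝 0) := by
  have hα := tendsto_fibonacci_alpha
  have herr : Tendsto (fun n : ℕ => (1 / ((n : ℝ) - 1) + 6 * (2 / 3) ^ n)) atTop (𝓝 0) := by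
    have h1 : Tendsto (fun n : ℕ => 1 / ((n : ℝ) - 1)) atTop (𝓝 0) := by
      simp only [one_div]
      exact tendsto_inv_atTop_zero.comp
        (tendsto_atTop_add_const_right _ (-1) tendsto_natCast_atTop_atTop)
    have h2 := (tendsto_pow_atTop_nhds_zero_of_lt_one (r := (2 / 3 : ℝ))
      (by norm_num) (by norm_num)).const_mul 6
    simpa using h1.add h2
  rw [Metric.tendsto_nhds]
  intro ε hε
  obtain ⟨n, hn2, hn⟩ := ((eventually_ge_atTop 2).and
    (herr.eventually_lt_const (half_pos hε))).exists
  have hA := (((continuous_sbLogSum n []).tendsto (1 / 2)).comp hα).abs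
  rw [sbLogSum_half_nil, abs_zero] at hA
  filter_upwards [hA.eventually_lt_const (half_pos hε),
    hα.eventually (Icc_mem_nhds (show (1 / 3 : ℝ) < 1 / 2 by norm_num)
      (show (1 / 2 : ℝ) < 2 / 3 by norm_num))] with p hp1 hp2
  have hp3 := (hν _ ⟨by linarith [hp2.1], by linarith [hp2.2]⟩).abs_integral_log_le hp2 hn2
  rw [Function.comp_apply] at hp1
  rw [Real.dist_eq, sub_zero]
  linarith
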